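/- Let Y ∈ ℝ^{n×n} be invertible and set X := √n · (YYᵀ)^{-1/2} Y. Then X Xᵀ = n·Iₙ, every row of X has Euclidean norm √n, and X is a fixed point of both SWAN pre-processing operations: √n · Q(X)^{-1} X = X and √n · (XXᵀ)^{-1/2} X = X. In particular, for square matrices a single iteration of alternating row-normalization and whitening reaches a common fixed point. -/

import Mathlib

open Matrix

/-- The Euclidean norm of the `i`-th row of a matrix. -/
noncomputable def rowNorm {n : ℕ} (W : Matrix (Fin n) (Fin n) ℝ) (i : Fin n) : ℝ :=
  Real.sqrt (∑ j, W i j ^ 2)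

/-- The only positive definite square root of `c ^ 2 • 1`, for `c > 0`, is `c • 1`. -/
theorem Matrix.PosDef.eq_smul_one_of_mul_self_eq {ι : Type*} [Fintype ι] [DecidableEq ι]
    {S : Matrix ι ι ℝ} (hS : S.PosDef) {c : ℝ} (hc : 0 < c)
    (h : S * S = (c * c) • (1 : Matrix ι ι ℝ)) : S = c • (1 : Matrix ι ι ℝ) := by
  have hU : IsUnit (S + c • (1 : Matrix ι ι ℝ)) := (hS.add (PosDef.one.smul hc)).isUnit
  refine sub_eq_zero.mp (hU.mul_left_eq_zero.mp ?_)
  simp [sub_mul, mul_add, h, smul_sub, smul_smul]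

theorem square_whitening_is_common_fixed_point
    {n : ℕ} (hn : 1 ≤ n) (Y : Matrix (Fin n) (Fin n) ℝ) (hY : IsUnit Y.det)
    -- `S` is the unique positive definite square root of `Y * Yᵀ`,
    -- so that `S⁻¹ = (Y Yᵀ)^{-1/2}`.
    (S : Matrix (Fin n) (Fin n) ℝ) (hS : S.PosDef) (hSS : S * S = Y * Yᵀ)
    (X : Matrix (Fin n) (Fin n) ℝ) (hX : X = Real.sqrt n • (S⁻¹ * Y)) :
    X * Xᵀ = (n : ℝ) • (1 : Matrix (Fin n) (Fin n) ℝ) ∧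
      (∀ i : Fin n, rowNorm X i = Real.sqrt n) ∧
      Real.sqrt n • ((Matrix.diagonal (rowNorm X))⁻¹ * X) = X ∧
      -- `S'` below ranges over positive definite square roots of `X * Xᵀ`,
      -- so that `S'⁻¹ = (X Xᵀ)^{-1/2}`.
      ∀ S' : Matrix (Fin n) (Fin n) ℝ, S'.PosDef → S' * S' = X * Xᵀ →
        Real.sqrt n • (S'⁻¹ * X) = X := by
  have hn0 : (0 : ℝ) < n := by exact_mod_cast hn
  have hc : 0 < Real.sqrt n := Real.sqrt_pos.mpr hn0
  have hcc : Real.sqrt n * Real.sqrt n = n := Real.mul_self_sqrt hn0.le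
  have hSdet : IsUnit S.det := (isUnit_iff_isUnit_det S).mp hS.isUnit
  have hST : Sᵀ = S := by simpa using hS.isHermitian.eq
  have hXX : X * Xᵀ = (n : ℝ) • (1 : Matrix (Fin n) (Fin n) ℝ) := by
    have hone : S⁻¹ * Y * (S⁻¹ * Y)ᵀ = 1 := by
      rw [transpose_mul, transpose_nonsing_inv, hST, Matrix.mul_assoc,
        ← Matrix.mul_assoc Y, ← hSS, Matrix.mul_assoc S, mul_nonsing_inv _ hSdet,
        Matrix.mul_one, nonsing_inv_mul _ hSdet]
    rw [hX, transpose_smul, smul_mul, Matrix.mul_smul, smul_smul, hcc, hone]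
  have hrow : ∀ i : Fin n, rowNorm X i = Real.sqrt n := by
    intro i
    have hi := congrFun (congrFun hXX i) i
    simp only [mul_apply, transpose_apply, Matrix.smul_apply, one_apply_eq, smul_eq_mul,
      mul_one] at hi
    simp only [rowNorm, pow_two, hi]
  have hfix : Real.sqrt n • ((Real.sqrt n • (1 : Matrix (Fin n) (Fin n) ℝ))⁻¹ * X) = X := by
    have hinv : (Real.sqrt n • (1 : Matrix (Fin n) (Fin n) ℝ))⁻¹ =
        (Real.sqrt n)⁻¹ • (1 : Matrix (Fin n) (Fin n) ℝ) := by
      apply inv_eq_right_inv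
      simp [smul_smul, hc.ne']
    rw [hinv, smul_mul, Matrix.one_mul, smul_smul, mul_inv_cancel₀ hc.ne', one_smul]
  refine ⟨hXX, hrow, ?_, fun S' hS' hSS' => ?_⟩
  · rw [funext hrow, ← smul_one_eq_diagonal, hfix]
  · rw [hS'.eq_smul_one_of_mul_self_eq hc (by rw [hSS', hXX, hcc]), hfix]
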